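/- arXiv:2112.13793 — 2 statements merged into one kernel-verified Lean document; each statement's English description precedes it below -/
import Mathlib

section
/- Let F be a field, X, Y, Z vector spaces over F, and x_1,…,x_n ∈ X, y_1,…,y_n ∈ Y, z_1,…,z_n ∈ Z. Let d = dim span{x_1,…,x_n}. Assume: (1) each x_i is nonzero and no two distinct x_i, x_j are parallel; (2) for every α ∈ F^n, the rank of the matrix (2-tensor) Σ_{i=1}^n α_i y_i ⊗ z_i is at least min(ω(α), n − d + 2), where ω(α) is the number of nonzero entries of α. Then the tensor θ = Σ_{i=1}^n x_i ⊗ y_i ⊗ z_i has tensor rank exactly n, and its representation as a sum of n product tensors is unique: if θ = Σ_{i=1}^n v_i ⊗ u_i ⊗ w_i, then the multisets {x_i ⊗ y_i ⊗ z_i : i ∈ [n]} and {v_i ⊗ u_i ⊗ w_i : i ∈ [n]} coincide. -/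
open TensorProduct

/-- The rank of a 2-tensor: minimal number of simple tensors summing to it. -/
noncomputable def tensorRank2 {F Y Z : Type*} [Field F]
    [AddCommGroup Y] [Module F Y] [AddCommGroup Z] [Module F Z]
    (t : TensorProduct F Y Z) : ℕ :=
  sInf {m | ∃ (a : Fin m → Y) (b : Fin m → Z), t = ∑ i, a i ⊗ₜ[F] b i}

/-- The rank of a 3-tensor: minimal number of product tensors summing to it. -/
noncomputable def tensorRank3 {F X Y Z : Type*} [Field F]
    [AddCommGroup X] [Module F X] [AddCommGroup Y] [Module F Y]
    [AddCommGroup Z] [Module F Z]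
    (t : TensorProduct F X (TensorProduct F Y Z)) : ℕ :=
  sInf {m | ∃ (a : Fin m → X) (b : Fin m → Y) (c : Fin m → Z),
    t = ∑ i, a i ⊗ₜ[F] (b i ⊗ₜ[F] c i)}

section LinearAlgebra

variable {F : Type*} [Field F] {ι : Type*}

theorem LinearIndepOn.exists_linearMap_apply_eq {V M : Type*} [AddCommGroup V] [Module F V]
    [AddCommGroup M] [Module F M] {y : ι → V} {s : Set ι} (hy : LinearIndepOn F y s) (g : ι → M) :
    ∃ h : V →ₗ[F] M, ∀ i ∈ s, h (y i) = g i := by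
  have hy' : LinearIndependent F (fun i : s => y i) := hy
  obtain ⟨h, hh⟩ := LinearMap.exists_extend
    ((Module.Basis.span hy').constr F (fun i : s => g i))
  refine ⟨h, fun i hi => ?_⟩
  have h1 := LinearMap.congr_fun hh (Module.Basis.span hy' ⟨i, hi⟩)
  rw [Module.Basis.constr_basis] at h1
  simpa [Module.Basis.span_apply] using h1

theorem LinearIndepOn.finrank_span_image {V : Type*} [AddCommGroup V] [Module F V] {y : ι → V}
    {s : Finset ι} (hy : LinearIndepOn F y s) :
    Module.finrank F (Submodule.span F (y '' s)) = s.card := by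
  have := finrank_span_eq_card (R := F) (b := fun i : (s : Set ι) => y i) hy
  rw [Set.image_eq_range, this]
  simp

variable {X Y Z : Type*} [AddCommGroup X] [Module F X] [AddCommGroup Y] [Module F Y]
  [AddCommGroup Z] [Module F Z]

theorem sum_smul_apply_eq_of_sum_tmul_eq {s t : Finset ι} {x v : ι → X} {M N : ι → Y}
    (h : ∑ i ∈ s, x i ⊗ₜ[F] M i = ∑ i ∈ t, v i ⊗ₜ[F] N i) (f : X →ₗ[F] F) :
    ∑ i ∈ s, f (x i) • M i = ∑ i ∈ t, f (v i) • N i := by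
  simpa using congrArg (fun a => TensorProduct.lid F Y (LinearMap.rTensor Y f a)) h

theorem mem_span_left_of_sum_tmul_eq {s : Finset ι} {c : ι → F} {y u : ι → Y} {z w : ι → Z}
    (hy : LinearIndepOn F y s) (hz : LinearIndepOn F z s) (hc : ∀ i ∈ s, c i ≠ 0)
    (h : ∑ i ∈ s, c i • (y i ⊗ₜ[F] z i) = ∑ i ∈ s, c i • (u i ⊗ₜ[F] w i)) :
    ∀ i ∈ s, u i ∈ Submodule.span F (y '' s) := by
  classical
  have hle : Submodule.span F (y '' s) ≤ Submodule.span F (u '' s) := by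
    rw [Submodule.span_le]
    rintro _ ⟨j, hj, rfl⟩
    obtain ⟨ψ, hψ⟩ := hz.exists_linearMap_apply_eq (fun i => if i = j then (1 : F) else 0)
    have h1 := congrArg (fun a => TensorProduct.rid F Y (LinearMap.lTensor Y ψ a)) h
    simp only [map_sum, map_smul, LinearMap.lTensor_tmul, TensorProduct.rid_tmul] at h1
    rw [Finset.sum_eq_single_of_mem j hj
      (fun b hb hbj => by simp [hψ b hb, hbj]), hψ j hj] at h1
    simp only [if_true, one_smul] at h1
    have h2 : c j • y j ∈ Submodule.span F (u '' s) := by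
      rw [h1]
      exact Submodule.sum_mem _ fun i hi => Submodule.smul_mem _ _ <| Submodule.smul_mem _ _ <|
        Submodule.subset_span ⟨i, hi, rfl⟩
    exact (Submodule.smul_mem_iff _ (hc j hj)).1 h2
  have hfin : FiniteDimensional F (Submodule.span F (u '' s)) :=
    FiniteDimensional.span_of_finite F (s.finite_toSet.image u)
  have hcard : Module.finrank F (Submodule.span F (u '' s)) ≤
      Module.finrank F (Submodule.span F (y '' s)) := by
    rw [hy.finrank_span_image, ← Finset.coe_image]
    exact (finrank_span_finset_le_card _).trans Finset.card_image_le
  rw [Submodule.eq_of_le_of_finrank_le hle hcard]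
  exact fun i hi => Submodule.subset_span ⟨i, hi, rfl⟩

theorem mem_span_right_of_sum_tmul_eq {s : Finset ι} {c : ι → F} {y u : ι → Y} {z w : ι → Z}
    (hy : LinearIndepOn F y s) (hz : LinearIndepOn F z s) (hc : ∀ i ∈ s, c i ≠ 0)
    (h : ∑ i ∈ s, c i • (y i ⊗ₜ[F] z i) = ∑ i ∈ s, c i • (u i ⊗ₜ[F] w i)) :
    ∀ i ∈ s, w i ∈ Submodule.span F (z '' s) :=
  mem_span_left_of_sum_tmul_eq hz hy hc
    (by simpa using congrArg (TensorProduct.comm F Y Z) h)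

theorem LinearMap.map_eq_zero_of_mem_span_image {V M : Type*} [AddCommGroup V] [Module F V]
    [AddCommGroup M] [Module F M] (h : V →ₗ[F] M) {y : ι → V} {s : Set ι}
    (hs : ∀ i ∈ s, h (y i) = 0) {a : V} (ha : a ∈ Submodule.span F (y '' s)) : h a = 0 := by
  have hle : Submodule.span F (y '' s) ≤ LinearMap.ker h := by
    rw [Submodule.span_le]
    rintro _ ⟨i, hi, rfl⟩
    exact hs i hi
  exact hle ha

/-- If two independent linear combinations of the differences `yᵢ ⊗ zᵢ - uᵢ ⊗ wᵢ` vanish, then so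
does the part of the second supported off the support of the first. -/
theorem sum_filter_smul_sub_eq_zero [DecidableEq F] {s : Finset ι} {p q : ι → F}
    {y u : ι → Y} {z w : ι → Z}
    (hy : LinearIndepOn F y s) (hz : LinearIndepOn F z s)
    (hpq : ∀ i ∈ s, p i = 0 → q i ≠ 0)
    (hp : ∑ i ∈ s, p i • (y i ⊗ₜ[F] z i - u i ⊗ₜ[F] w i) = 0)
    (hq : ∑ i ∈ s, q i • (y i ⊗ₜ[F] z i - u i ⊗ₜ[F] w i) = 0) :
    ∑ i ∈ s with p i = 0, q i • (y i ⊗ₜ[F] z i - u i ⊗ₜ[F] w i) = 0 := by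
  set T := s.filter (fun i => p i = 0)
  set R := s.filter (fun i => ¬ p i = 0)
  have hTs : (T : Set ι) ⊆ s := Finset.coe_subset.2 (Finset.filter_subset _ _)
  have hRs : (R : Set ι) ⊆ s := Finset.coe_subset.2 (Finset.filter_subset _ _)
  have hpR : ∑ i ∈ R, p i • (y i ⊗ₜ[F] z i) = ∑ i ∈ R, p i • (u i ⊗ₜ[F] w i) := by
    rw [← sub_eq_zero, ← Finset.sum_sub_distrib]
    rw [← Finset.sum_filter_add_sum_filter_not s (fun i => p i = 0)] at hp
    rw [Finset.sum_eq_zero (s := s.filter (fun i => p i = 0))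
      (fun i hi => by simp [(Finset.mem_filter.1 hi).2]), zero_add] at hp
    simpa only [smul_sub] using hp
  have hR0 : ∀ i ∈ R, p i ≠ 0 := fun i hi => (Finset.mem_filter.1 hi).2
  have huR := mem_span_left_of_sum_tmul_eq (hy.mono hRs) (hz.mono hRs) hR0 hpR
  have hwR := mem_span_right_of_sum_tmul_eq (hy.mono hRs) (hz.mono hRs) hR0 hpR
  obtain ⟨ρ, hρ⟩ := hy.exists_linearMap_apply_eq (fun i => if p i = 0 then y i else 0)
  obtain ⟨π, hπ⟩ := hz.exists_linearMap_apply_eq (fun i => if p i = 0 then z i else 0)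
  have hρT : ∀ i ∈ T, ρ (y i) = y i := fun i hi => by
    rw [hρ i (hTs hi), if_pos (Finset.mem_filter.1 hi).2]
  have hπT : ∀ i ∈ T, π (z i) = z i := fun i hi => by
    rw [hπ i (hTs hi), if_pos (Finset.mem_filter.1 hi).2]
  have hρR : ∀ i ∈ R, ρ (y i) = 0 := fun i hi => by
    rw [hρ i (hRs hi), if_neg (hR0 i hi)]
  have hπR : ∀ i ∈ R, π (z i) = 0 := fun i hi => by
    rw [hπ i (hRs hi), if_neg (hR0 i hi)]
  rw [← Finset.sum_filter_add_sum_filter_not s (fun i => p i = 0)] at hq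
  have huT : ∀ i ∈ T, u i ∈ Submodule.span F (y '' T) := by
    refine mem_span_left_of_sum_tmul_eq (c := q) (z := z) (w := fun i => π (w i))
      (hy.mono hTs) (hz.mono hTs)
      (fun i hi => hpq i (hTs hi) (Finset.mem_filter.1 hi).2) ?_
    have h1 := congrArg (LinearMap.lTensor Y π) hq
    simp only [map_add, map_sum, map_smul, map_sub, LinearMap.lTensor_tmul, map_zero] at h1
    rw [Finset.sum_eq_zero (s := R) (fun i hi => by
      rw [hπR i hi, π.map_eq_zero_of_mem_span_image hπR (hwR i hi)]; simp), add_zero] at h1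
    rw [← sub_eq_zero, ← Finset.sum_sub_distrib, ← h1]
    exact Finset.sum_congr rfl fun i hi => by rw [hπT i hi, smul_sub]
  have hρu : ∀ i ∈ T, ρ (u i) = u i := fun i hi => by
    have := (ρ - LinearMap.id).map_eq_zero_of_mem_span_image
      (fun j hj => by simp [hρT j hj]) (huT i hi)
    simpa [sub_eq_zero] using this
  have h1 := congrArg (LinearMap.rTensor Z ρ) hq
  simp only [map_add, map_sum, map_smul, map_sub, LinearMap.rTensor_tmul, map_zero] at h1
  rw [Finset.sum_eq_zero (s := R) (fun i hi => by
    rw [hρR i hi, ρ.map_eq_zero_of_mem_span_image hρR (huR i hi)]; simp), add_zero] at h1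
  rw [← h1]
  exact Finset.sum_congr rfl fun i hi => by rw [hρT i hi, hρu i hi]

/-- Uniqueness of the second and third factors when the first factors agree. -/
theorem tmul_eq_of_sum_tmul_sub_eq_zero {x : ι → X} {y u : ι → Y} {z w : ι → Z} {r : ℕ}
    (hx0 : ∀ i, x i ≠ 0) (hpar : ∀ i j, i ≠ j → x j ∉ Submodule.span F {x i}) :
    ∀ A : Finset ι,
      (∀ s ⊆ A, s.card ≤ r + 2 → LinearIndepOn F y s) →
      (∀ s ⊆ A, s.card ≤ r + 2 → LinearIndepOn F z s) →
      A.card ≤ r + Module.finrank F (Submodule.span F (x '' A)) →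
      ∑ i ∈ A, x i ⊗ₜ[F] (y i ⊗ₜ[F] z i - u i ⊗ₜ[F] w i) = 0 →
      ∀ i ∈ A, y i ⊗ₜ[F] z i = u i ⊗ₜ[F] w i := by
  classical
  intro A
  induction A using Finset.strongInduction with
  | H A ih =>
  intro hy hz hcard hsum i hi
  have hi' : LinearIndepOn F x {i} := LinearIndepOn.singleton (hx0 i)
  obtain ⟨B', hiB', hB'A, hspan', hB'⟩ : ∃ B' : Set ι, {i} ⊆ B' ∧ B' ⊆ A ∧
      x '' A ⊆ Submodule.span F (x '' B') ∧ LinearIndepOn F x B' := by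
    have hiA : ({i} : Set ι) ⊆ A := by simpa using hi
    obtain ⟨b, h1, h2, h3, h4⟩ := exists_linearIndepOn_extension hi' hiA
    exact ⟨b, h2, h1, h3, h4⟩
  lift B' to Finset ι using A.finite_toSet.subset hB'A with B
  have hiB : i ∈ B := by simpa using hiB'
  have hBA : B ⊆ A := by exact_mod_cast hB'A
  have hspan : Submodule.span F (x '' A) = Submodule.span F (x '' B) :=
    le_antisymm (Submodule.span_le.2 hspan') (Submodule.span_mono (Set.image_mono hBA))
  rw [hspan, hB'.finrank_span_image] at hcard
  choose e he using fun b =>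
    hB'.exists_linearMap_apply_eq (fun j => if j = b then (1 : F) else 0)
  have hexp : ∀ j ∈ A, x j = ∑ b ∈ B, e b (x j) • x b := by
    intro j hj
    have h0 := (LinearMap.id - ∑ b ∈ B, (e b).smulRight (x b)).map_eq_zero_of_mem_span_image
      (y := x) (s := B) (fun k hk => by
        simp only [LinearMap.sub_apply, LinearMap.id_apply, LinearMap.sum_apply,
          LinearMap.smulRight_apply]
        rw [Finset.sum_eq_single_of_mem k hk (fun b hb hbk => by
          rw [he b k hk, if_neg hbk.symm, zero_smul]), he k k hk]
        simp) (hspan' ⟨j, hj, rfl⟩)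
    simpa [sub_eq_zero] using h0
  have hf : ∀ f : X →ₗ[F] F,
      ∑ j ∈ A, f (x j) • (y j ⊗ₜ[F] z j - u j ⊗ₜ[F] w j) = 0 := fun f => by
    simpa using congrArg (fun a => TensorProduct.lid F (Y ⊗[F] Z) (LinearMap.rTensor _ f a)) hsum
  by_cases hBi : B = {i}
  · have hA : A = {i} := by
      refine Finset.eq_singleton_iff_unique_mem.2 ⟨hi, fun j hj => ?_⟩
      by_contra hji
      refine hpar i j (Ne.symm hji) ?_
      have := hspan' ⟨j, hj, rfl⟩
      simpa [hBi] using this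
    have h1 := hf (e i)
    rw [hA, Finset.sum_singleton, he i i (by simpa using hiB)] at h1
    simpa [sub_eq_zero] using h1
  obtain ⟨b₀, hb₀, hb₀i⟩ : ∃ b₀ ∈ B, b₀ ≠ i := by
    by_contra! h
    exact hBi (Finset.eq_singleton_iff_unique_mem.2 ⟨hiB, h⟩)
  have hA'A : A.filter (fun j => e b₀ (x j) = 0) ⊂ A := by
    refine Finset.filter_ssubset.2 ⟨b₀, hBA hb₀, ?_⟩
    rw [he b₀ b₀ hb₀]
    simp
  have hBA' : B.erase b₀ ⊆ A.filter (fun j => e b₀ (x j) = 0) := by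
    intro k hk
    obtain ⟨hk1, hk2⟩ := Finset.mem_erase.1 hk
    exact Finset.mem_filter.2 ⟨hBA hk2, by rw [he b₀ k hk2, if_neg hk1]⟩
  refine ih _ hA'A (fun s hs => hy s (hs.trans hA'A.subset))
    (fun s hs => hz s (hs.trans hA'A.subset)) ?_ ?_ i
    (hBA' (Finset.mem_erase.2 ⟨hb₀i.symm, hiB⟩))
  · have h1 : Module.finrank F (Submodule.span F (x '' (B.erase b₀ : Finset ι))) ≤
        Module.finrank F (Submodule.span F
          (x '' (A.filter (fun j => e b₀ (x j) = 0) : Finset ι))) := by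
      have : FiniteDimensional F (Submodule.span F
          (x '' (A.filter (fun j => e b₀ (x j) = 0) : Finset ι))) :=
        FiniteDimensional.span_of_finite F ((Finset.finite_toSet _).image x)
      exact Submodule.finrank_mono (Submodule.span_mono (Set.image_mono hBA'))
    rw [(hB'.mono (by simp)).finrank_span_image, Finset.card_erase_of_mem hb₀] at h1
    have h2 := Finset.card_lt_card hA'A
    have h3 : 0 < B.card := Finset.card_pos.2 ⟨_, hb₀⟩
    omega
  · have hcoord : ∀ b ∈ B, ∑ j ∈ A with e b₀ (x j) = 0,
        e b (x j) • (y j ⊗ₜ[F] z j - u j ⊗ₜ[F] w j) = 0 := by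
      intro b hb
      by_cases hbb : b = b₀
      · subst hbb
        exact Finset.sum_eq_zero fun j hj => by simp [(Finset.mem_filter.1 hj).2]
      set s := A.filter (fun j => e b₀ (x j) ≠ 0 ∨ e b (x j) ≠ 0)
      have hsA : s ⊆ A := Finset.filter_subset _ _
      have hscard : s.card ≤ r + 2 := by
        have h1 : s ⊆ insert b₀ (insert b (A \ B)) := by
          intro j hj
          obtain ⟨hjA, hj⟩ := Finset.mem_filter.1 hj
          simp only [Finset.mem_insert, Finset.mem_sdiff]
          by_contra! hcon
          have hjB := hcon.2.2 hjA
          rw [he b₀ j hjB, he b j hjB, if_neg hcon.1, if_neg hcon.2.1] at hj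
          simp at hj
        have h2 := Finset.card_le_card h1
        have h3 := Finset.card_insert_le b₀ (insert b (A \ B))
        have h4 := Finset.card_insert_le b (A \ B)
        have h5 := Finset.card_sdiff_add_card_eq_card hBA
        omega
      have hzero : ∀ f : X →ₗ[F] F, (∀ j ∈ A, j ∉ s → f (x j) = 0) →
          ∑ j ∈ s, f (x j) • (y j ⊗ₜ[F] z j - u j ⊗ₜ[F] w j) = 0 := by
        intro f hfs
        rw [← hf f]
        exact Finset.sum_subset hsA fun j hj hjs => by rw [hfs j hj hjs, zero_smul]
      have key := sum_filter_smul_sub_eq_zero (p := fun j => e b₀ (x j))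
        (q := fun j => e b (x j)) (hy s hsA hscard) (hz s hsA hscard)
        (fun j hj h => (Finset.mem_filter.1 hj).2.resolve_left (not_not.2 h))
        (hzero _ fun j hj hjs => by
          by_contra h; exact hjs (Finset.mem_filter.2 ⟨hj, Or.inl h⟩))
        (hzero _ fun j hj hjs => by
          by_contra h; exact hjs (Finset.mem_filter.2 ⟨hj, Or.inr h⟩))
      rw [← key]
      refine (Finset.sum_subset (Finset.filter_subset_filter _ hsA) fun j hj hjs => ?_).symm
      obtain ⟨hjA, hj0⟩ := Finset.mem_filter.1 hj
      by_contra h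
      refine hjs (Finset.mem_filter.2 ⟨Finset.mem_filter.2 ⟨hjA, Or.inr fun h0 => h ?_⟩, hj0⟩)
      rw [h0, zero_smul]
    calc ∑ j ∈ A with e b₀ (x j) = 0, x j ⊗ₜ[F] (y j ⊗ₜ[F] z j - u j ⊗ₜ[F] w j)
        = ∑ j ∈ A with e b₀ (x j) = 0, ∑ b ∈ B,
            x b ⊗ₜ[F] (e b (x j) • (y j ⊗ₜ[F] z j - u j ⊗ₜ[F] w j)) := by
          refine Finset.sum_congr rfl fun j hj => ?_
          conv_lhs => rw [hexp j (Finset.mem_filter.1 hj).1]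
          rw [TensorProduct.sum_tmul]
          exact Finset.sum_congr rfl fun b _ => TensorProduct.smul_tmul _ _ _
      _ = 0 := by
          rw [Finset.sum_comm]
          refine Finset.sum_eq_zero fun b hb => ?_
          rw [← TensorProduct.tmul_sum, hcoord b hb, TensorProduct.tmul_zero]

end LinearAlgebra

section PermutationLemma

open scoped Classical in
theorem card_filter_mem_sup_span {F V ι : Type*} [Field F] [AddCommGroup V] [Module F V]
    [Fintype ι] (t : ι → V) (W : Submodule F V) (v : V) :
    (Finset.univ.filter (fun i => t i ∈ W ⊔ Submodule.span F {v})).card =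
      (Finset.univ.filter (fun i => t i ∈ W)).card +
      (Finset.univ.filter (fun i => t i ∉ W ∧
        W ⊔ Submodule.span F {t i} = W ⊔ Submodule.span F {v})).card := by
  rw [← Finset.card_union_of_disjoint
    (Finset.disjoint_filter.2 fun i _ hi hi' => hi'.1 hi)]
  congr 1
  ext i
  simp only [Finset.mem_filter, Finset.mem_univ, true_and, Finset.mem_union]
  constructor
  · intro hi
    by_cases hiW : t i ∈ W
    · exact Or.inl hiW
    refine Or.inr ⟨hiW, le_antisymm (sup_le le_sup_left ?_) (sup_le le_sup_left ?_)⟩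
    · simpa [Submodule.span_singleton_le_iff_mem] using hi
    · rw [Submodule.span_singleton_le_iff_mem]
      obtain ⟨a, ha, b, hb, hab⟩ := Submodule.mem_sup.1 hi
      obtain ⟨c, rfl⟩ := Submodule.mem_span_singleton.1 hb
      have hc : c ≠ 0 := by
        rintro rfl
        exact hiW (by simpa [← hab] using ha)
      refine Submodule.mem_sup.2 ⟨-(c⁻¹ • a), W.neg_mem (W.smul_mem _ ha), c⁻¹ • t i,
        Submodule.smul_mem _ _ (Submodule.mem_span_singleton_self _), ?_⟩
      rw [← hab, smul_add, smul_smul, inv_mul_cancel₀ hc, one_smul]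
      abel
  · rintro (hi | ⟨-, hi⟩)
    · exact Submodule.mem_sup_left hi
    · rw [← hi]
      exact Submodule.mem_sup_right (Submodule.mem_span_singleton_self _)

variable {F X ι : Type*} [Field F] [AddCommGroup X] [Module F X] [Fintype ι]

open scoped Classical in
theorem card_filter_mem_span_le {x v : ι → X}
    (h : ∀ f : X →ₗ[F] F,
      min (Finset.univ.filter (fun i => f (x i) ≠ 0)).card
        (Fintype.card ι - Module.finrank F (Submodule.span F (Set.range x)) + 2) ≤
      (Finset.univ.filter (fun i => f (v i) ≠ 0)).card) (S : Finset ι) :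
    (Finset.univ.filter (fun i => v i ∈ Submodule.span F (v '' S))).card ≤
      (Finset.univ.filter (fun i => x i ∈ Submodule.span F (v '' S))).card := by
  have hxv : ∀ i, x i ∈ Submodule.span F (Set.range v) := by
    intro i
    by_contra hi
    obtain ⟨f, hfi, hf⟩ := Submodule.exists_le_ker_of_notMem hi
    have h0 := h f
    have h1 : (Finset.univ.filter (fun i => f (v i) ≠ 0)).card = 0 := by
      rw [Finset.card_eq_zero, Finset.filter_eq_empty_iff]
      exact fun j _ => not_not.2 (hf (Submodule.subset_span ⟨j, rfl⟩))
    have h2 : 0 < (Finset.univ.filter (fun i => f (x i) ≠ 0)).card :=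
      Finset.card_pos.2 ⟨i, by simpa using hfi⟩
    omega
  induction hm : Fintype.card ι - S.card using Nat.strong_induction_on generalizing S with
  | _ m ih =>
  subst hm
  set W := Submodule.span F (v '' S)
  have hinsert : ∀ j, W ⊔ Submodule.span F {v j} =
      Submodule.span F (v '' (insert j S : Finset ι)) := fun j => by
    rw [Finset.coe_insert, Set.image_insert_eq, Submodule.span_insert, sup_comm]
  set C := (Finset.univ.filter (fun i => v i ∉ W)).image
    (fun i => W ⊔ Submodule.span F {v i})
  have hmemC : ∀ i, v i ∉ W → W ⊔ Submodule.span F {v i} ∈ C := fun i hi =>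
    Finset.mem_image.2 ⟨i, Finset.mem_filter.2 ⟨Finset.mem_univ i, hi⟩, rfl⟩
  have hstep : ∀ H ∈ C, (Finset.univ.filter (fun i => v i ∈ H)).card ≤
      (Finset.univ.filter (fun i => x i ∈ H)).card := by
    intro H hH
    obtain ⟨j, hj, rfl⟩ := Finset.mem_image.1 hH
    have hjW := (Finset.mem_filter.1 hj).2
    rw [hinsert]
    have hjS : j ∉ S := fun hjS => hjW (Submodule.subset_span ⟨j, hjS, rfl⟩)
    have h1 := Finset.card_insert_of_notMem hjS
    have h2 : (insert j S).card ≤ Fintype.card ι := Finset.card_le_univ _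
    exact ih _ (by omega) _ rfl
  have hcompl : ∀ t : ι → X, (Finset.univ.filter (fun i => t i ∈ W)).card +
      (Finset.univ.filter (fun i => t i ∉ W)).card = Fintype.card ι := fun t =>
    Finset.card_filter_add_card_filter_not _
  rcases Nat.lt_or_ge 1 C.card with hC1 | hC1
  · set P : (ι → X) → Submodule F X → Finset ι := fun t H =>
      Finset.univ.filter (fun i => t i ∉ W ∧ W ⊔ Submodule.span F {t i} = H)
    have hPcard : ∀ t : ι → X, ∀ H ∈ C, (Finset.univ.filter (fun i => t i ∈ H)).card =
        (Finset.univ.filter (fun i => t i ∈ W)).card + (P t H).card := by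
      intro t H hH
      obtain ⟨j, -, rfl⟩ := Finset.mem_image.1 hH
      exact card_filter_mem_sup_span t W (v j)
    have hv : (Finset.univ.filter (fun i => v i ∉ W)).card = ∑ H ∈ C, (P v H).card := by
      rw [Finset.card_eq_sum_card_image (fun i => W ⊔ Submodule.span F {v i})]
      exact Finset.sum_congr rfl fun H _ => by rw [Finset.filter_filter]
    have hx : ∑ H ∈ C, (P x H).card ≤ (Finset.univ.filter (fun i => x i ∉ W)).card := by
      rw [← Finset.card_biUnion]
      · refine Finset.card_le_card fun i hi => ?_
        obtain ⟨H, -, hi⟩ := Finset.mem_biUnion.1 hi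
        exact Finset.mem_filter.2 ⟨Finset.mem_univ _, (Finset.mem_filter.1 hi).2.1⟩
      · intro H _ H' _ hHH'
        exact Finset.disjoint_filter.2 fun i _ hi hi' => hHH' (hi.2.symm.trans hi'.2)
    have hsum := Finset.sum_le_sum hstep
    rw [Finset.sum_congr rfl (hPcard v), Finset.sum_congr rfl (hPcard x),
      Finset.sum_add_distrib, Finset.sum_add_distrib, Finset.sum_const, Finset.sum_const,
      smul_eq_mul, smul_eq_mul] at hsum
    have hv' := hcompl v
    have hx' := hcompl x
    nlinarith
  rcases Finset.eq_empty_or_nonempty C with hC0 | ⟨H, hH⟩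
  · have hvW : ∀ i, v i ∈ W := by
      intro i
      by_contra hi
      simpa [hC0] using hmemC i hi
    have hle : Submodule.span F (Set.range v) ≤ W := by
      rw [Submodule.span_le]
      rintro _ ⟨i, rfl⟩
      exact hvW i
    exact Finset.card_le_card fun i _ => by simpa using hle (hxv i)
  · obtain ⟨j, hj, rfl⟩ := Finset.mem_image.1 hH
    have hjW := (Finset.mem_filter.1 hj).2
    have hle : Submodule.span F (Set.range v) ≤ W ⊔ Submodule.span F {v j} := by
      rw [Submodule.span_le]
      rintro _ ⟨i, rfl⟩
      by_cases hi : v i ∈ W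
      · exact Submodule.mem_sup_left hi
      rw [← Finset.card_le_one.1 hC1 _ (hmemC i hi) _ hH]
      exact Submodule.mem_sup_right (Submodule.mem_span_singleton_self _)
    obtain ⟨f, hfj, hf⟩ := Submodule.exists_le_ker_of_notMem hjW
    have hker : ∀ a ∈ Submodule.span F (Set.range v), f a ≠ 0 ↔ a ∉ W := by
      intro a ha
      refine not_congr ⟨fun hfa => ?_, fun haW => hf haW⟩
      obtain ⟨b, hb, c, hc, rfl⟩ := Submodule.mem_sup.1 (hle ha)
      obtain ⟨k, rfl⟩ := Submodule.mem_span_singleton.1 hc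
      have hfb : f b = 0 := hf hb
      have hk : k = 0 := by simpa [hfb, hfj] using hfa
      simpa [hk] using hb
    have hf' := h f
    rw [Finset.filter_congr fun i _ => hker (x i) (hxv i),
      Finset.filter_congr fun i _ => hker (v i) (Submodule.subset_span ⟨i, rfl⟩)] at hf'
    have h1 : S.card ≤ (Finset.univ.filter (fun i => v i ∈ W)).card :=
      Finset.card_le_card fun i hi => by
        simpa using Submodule.subset_span (R := F) (Set.mem_image_of_mem v hi)
    have h2 : Module.finrank F (Submodule.span F (Set.range x)) ≤ S.card + 1 := by
      have hx_le : Submodule.span F (Set.range x) ≤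
          Submodule.span F (v '' (insert j S : Finset ι)) := by
        rw [Submodule.span_le, ← hinsert]
        rintro _ ⟨i, rfl⟩
        exact hle (hxv i)
      have hfin : FiniteDimensional F (Submodule.span F (v '' (insert j S : Finset ι))) :=
        FiniteDimensional.span_of_finite F ((Finset.finite_toSet _).image v)
      refine (Submodule.finrank_mono hx_le).trans ?_
      rw [← Finset.coe_image]
      exact (finrank_span_finset_le_card _).trans
        (Finset.card_image_le.trans (Finset.card_insert_le _ _))
    have hv' := hcompl v
    have hx' := hcompl x
    omega

/-- Kruskal's permutation lemma for families that are pairwise non-parallel. -/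
theorem exists_equiv_eq_smul {x v : ι → X} (hx0 : ∀ i, x i ≠ 0)
    (hpar : ∀ i j, i ≠ j → x j ∉ Submodule.span F {x i})
    (h : ∀ f : X →ₗ[F] F,
      min {i | f (x i) ≠ 0}.ncard
        (Fintype.card ι - Module.finrank F (Submodule.span F (Set.range x)) + 2) ≤
      {i | f (v i) ≠ 0}.ncard) :
    ∃ (σ : Equiv.Perm ι) (c : ι → F), ∀ i, v i = c i • x (σ i) := by
  classical
  have h' := card_filter_mem_span_le (x := x) (v := v) fun f => by
    simpa [Set.ncard_eq_toFinset_card'] using h f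
  have hv0 : ∀ i, v i ≠ 0 := by
    intro i hi
    have h0 := h' ∅
    have h1 : 0 < (Finset.univ.filter
      (fun i => v i ∈ Submodule.span F (v '' (∅ : Finset ι)))).card :=
      Finset.card_pos.2 ⟨i, by simp [hi]⟩
    obtain ⟨j, hj⟩ := Finset.card_pos.1 (h1.trans_le h0)
    exact hx0 j (by simpa using hj)
  have hS : ∀ i, (Finset.univ.filter (fun j => v j ∈ Submodule.span F {v i})).card ≤
      (Finset.univ.filter (fun j => x j ∈ Submodule.span F {v i})).card := fun i => by
    simpa using h' {i}
  have hswap : ∀ {a b : X}, a ≠ 0 → a ∈ Submodule.span F {b} → b ∈ Submodule.span F {a} := by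
    intro a b ha hab
    obtain ⟨k, rfl⟩ := Submodule.mem_span_singleton.1 hab
    have hk : k ≠ 0 := fun hk => ha (by simp [hk])
    exact Submodule.mem_span_singleton.2 ⟨k⁻¹, by rw [smul_smul, inv_mul_cancel₀ hk, one_smul]⟩
  have htrans : ∀ {a b c : X}, a ∈ Submodule.span F {b} → b ∈ Submodule.span F {c} →
      a ∈ Submodule.span F {c} := fun hab hbc =>
    (Submodule.span_singleton_le_iff_mem _ _).2 hbc hab
  have hex : ∀ i, ∃ j, x j ∈ Submodule.span F {v i} := by
    intro i
    have h1 : 0 < (Finset.univ.filter (fun j => v j ∈ Submodule.span F {v i})).card :=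
      Finset.card_pos.2 ⟨i, by simp⟩
    obtain ⟨j, hj⟩ := Finset.card_pos.1 (h1.trans_le (hS i))
    exact ⟨j, by simpa using hj⟩
  choose τ hτ using hex
  have hinj : Function.Injective τ := by
    intro i k hik
    by_contra hne
    have hvk : v k ∈ Submodule.span F {v i} :=
      htrans (hswap (hx0 _) (hτ k)) (hik ▸ hτ i)
    have h1 : 1 < (Finset.univ.filter (fun j => v j ∈ Submodule.span F {v i})).card :=
      Finset.one_lt_card.2 ⟨i, by simp,
        k, by simpa using hvk, hne⟩
    obtain ⟨a, ha, b, hb, hab⟩ := Finset.one_lt_card.1 (h1.trans_le (hS i))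
    exact hpar a b hab (htrans (by simpa using hb) (hswap (hx0 a) (by simpa using ha)))
  have hc : ∀ i, ∃ c : F, c • x (τ i) = v i := fun i =>
    Submodule.mem_span_singleton.1 (hswap (hx0 _) (hτ i))
  choose c hc using hc
  exact ⟨Equiv.ofBijective τ hinj.bijective_of_finite, c, fun i => (hc i).symm⟩

end PermutationLemma

section TensorRank

variable {F X Y Z ι : Type*} [Field F] [AddCommGroup X] [Module F X] [AddCommGroup Y] [Module F Y]
  [AddCommGroup Z] [Module F Z]

theorem tensorRank2_sum_le_card (s : Finset ι) (a : ι → Y) (b : ι → Z) :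
    tensorRank2 (∑ i ∈ s, a i ⊗ₜ[F] b i) ≤ s.card := by
  refine Nat.sInf_le ⟨fun k => a (s.equivFin.symm k), fun k => b (s.equivFin.symm k), ?_⟩
  rw [Equiv.sum_comp s.equivFin.symm (fun i : s => a i ⊗ₜ[F] b i),
    Finset.sum_coe_sort s (fun i => a i ⊗ₜ[F] b i)]

theorem tensorRank2_sum_smul_le_ncard [Fintype ι] (α : ι → F) (a : ι → Y) (b : ι → Z) :
    tensorRank2 (∑ i, α i • (a i ⊗ₜ[F] b i)) ≤ {i | α i ≠ 0}.ncard := by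
  classical
  have h := tensorRank2_sum_le_card (F := F) (Finset.univ.filter (fun i => α i ≠ 0))
    (fun i => α i • a i) b
  rw [Finset.sum_filter_of_ne (p := fun i => α i ≠ 0)
    (fun i _ hi hα => hi (by rw [hα, zero_smul, TensorProduct.zero_tmul]))] at h
  simpa [Set.ncard_eq_toFinset_card', TensorProduct.smul_tmul'] using h

theorem exists_sum_eq_sum_erase_of_not_linearIndepOn [DecidableEq ι] {s : Finset ι} {y : ι → Y}
    (h : ¬ LinearIndepOn F y s) : ∃ k ∈ s, ∃ c : ι → F, y k = ∑ i ∈ s.erase k, c i • y i := by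
  rw [linearIndepOn_finset_iff] at h
  push Not at h
  obtain ⟨c, hc, k, hk, hck⟩ := h
  refine ⟨k, hk, fun i => -((c k)⁻¹ * c i), ?_⟩
  rw [← Finset.add_sum_erase _ _ hk, add_comm, add_eq_zero_iff_eq_neg] at hc
  simp only [neg_smul, mul_smul, Finset.sum_neg_distrib, ← Finset.smul_sum]
  rw [hc, smul_neg, neg_neg, smul_smul, inv_mul_cancel₀ hck, one_smul]

theorem linearIndepOn_left_of_card_le_tensorRank2 {s : Finset ι} {y : ι → Y} {z : ι → Z}
    (h : s.card ≤ tensorRank2 (∑ i ∈ s, y i ⊗ₜ[F] z i)) : LinearIndepOn F y s := by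
  classical
  by_contra hy
  obtain ⟨k, hk, c, hc⟩ := exists_sum_eq_sum_erase_of_not_linearIndepOn hy
  have h1 : ∑ i ∈ s, y i ⊗ₜ[F] z i = ∑ i ∈ s.erase k, y i ⊗ₜ[F] (z i + c i • z k) := by
    rw [← Finset.sum_erase_add _ _ hk, hc, TensorProduct.sum_tmul, ← Finset.sum_add_distrib]
    exact Finset.sum_congr rfl fun i _ => by rw [TensorProduct.tmul_add, TensorProduct.smul_tmul]
  rw [h1] at h
  have := h.trans (tensorRank2_sum_le_card _ _ _)
  exact absurd this (not_le.2 (Finset.card_erase_lt_of_mem hk))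

theorem linearIndepOn_right_of_card_le_tensorRank2 {s : Finset ι} {y : ι → Y} {z : ι → Z}
    (h : s.card ≤ tensorRank2 (∑ i ∈ s, y i ⊗ₜ[F] z i)) : LinearIndepOn F z s := by
  classical
  by_contra hz
  obtain ⟨k, hk, c, hc⟩ := exists_sum_eq_sum_erase_of_not_linearIndepOn hz
  have h1 : ∑ i ∈ s, y i ⊗ₜ[F] z i = ∑ i ∈ s.erase k, (y i + c i • y k) ⊗ₜ[F] z i := by
    rw [← Finset.sum_erase_add _ _ hk, hc, TensorProduct.tmul_sum, ← Finset.sum_add_distrib]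
    exact Finset.sum_congr rfl fun i _ => by
      rw [TensorProduct.add_tmul, TensorProduct.smul_tmul]
  rw [h1] at h
  have := h.trans (tensorRank2_sum_le_card _ _ _)
  exact absurd this (not_le.2 (Finset.card_erase_lt_of_mem hk))

theorem exists_perm_tmul_eq_of_sum_eq [Fintype ι] {x v : ι → X} {y u : ι → Y} {z w : ι → Z}
    (hx0 : ∀ i, x i ≠ 0) (hpar : ∀ i j, i ≠ j → x j ∉ Submodule.span F {x i})
    (hU : ∀ α : ι → F,
      min {i | α i ≠ 0}.ncard
        (Fintype.card ι - Module.finrank F (Submodule.span F (Set.range x)) + 2) ≤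
        tensorRank2 (∑ i, α i • (y i ⊗ₜ[F] z i)))
    (h : ∑ i, x i ⊗ₜ[F] (y i ⊗ₜ[F] z i) = ∑ i, v i ⊗ₜ[F] (u i ⊗ₜ[F] w i)) :
    ∃ σ : Equiv.Perm ι, ∀ i,
      v i ⊗ₜ[F] (u i ⊗ₜ[F] w i) = x (σ i) ⊗ₜ[F] (y (σ i) ⊗ₜ[F] z (σ i)) := by
  classical
  obtain ⟨σ, c, hσ⟩ := exists_equiv_eq_smul (v := v) hx0 hpar fun f => by
    refine (hU _).trans ?_
    rw [sum_smul_apply_eq_of_sum_tmul_eq h f]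
    exact tensorRank2_sum_smul_le_ncard _ _ _
  have hv : ∀ i, v i ⊗ₜ[F] (u i ⊗ₜ[F] w i) = x (σ i) ⊗ₜ[F] ((c i • u i) ⊗ₜ[F] w i) := fun i => by
    rw [hσ, TensorProduct.smul_tmul, TensorProduct.smul_tmul']
  have hrank : ∀ s : Finset ι,
      s.card ≤ Fintype.card ι - Module.finrank F (Submodule.span F (Set.range x)) + 2 →
      s.card ≤ tensorRank2 (∑ i ∈ s, y i ⊗ₜ[F] z i) := by
    intro s hs
    have h1 := hU fun i => if i ∈ s then 1 else 0
    simpa [ite_smul, Finset.sum_ite_mem, hs] using h1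
  refine ⟨σ, fun i => ?_⟩
  have key := tmul_eq_of_sum_tmul_sub_eq_zero (x := x) (y := y) (z := z)
    (u := fun j => c (σ.symm j) • u (σ.symm j)) (w := fun j => w (σ.symm j)) hx0 hpar Finset.univ
    (fun s _ hs => linearIndepOn_left_of_card_le_tensorRank2 (hrank s hs))
    (fun s _ hs => linearIndepOn_right_of_card_le_tensorRank2 (hrank s hs))
    (by
      rw [Finset.coe_univ, Set.image_univ, Finset.card_univ]
      omega)
    (by
      simp only [TensorProduct.tmul_sub, Finset.sum_sub_distrib]
      rw [h, sub_eq_zero, ← Equiv.sum_comp σ (fun j =>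
        x j ⊗ₜ[F] ((c (σ.symm j) • u (σ.symm j)) ⊗ₜ[F] w (σ.symm j)))]
      simp only [hv, Equiv.symm_apply_apply]) (σ i) (Finset.mem_univ _)
  rw [hv, key]
  simp

end TensorRank

/-- Main theorem: Condition U together with pairwise non-parallel nonzero `x i`
implies that `θ = ∑ xᵢ ⊗ yᵢ ⊗ zᵢ` has rank `n` and its representation as a sum of
`n` product tensors is unique (as a multiset of product tensors). -/
theorem conditionU_implies_unique_decomposition
    (F X Y Z : Type*) [Field F] [AddCommGroup X] [Module F X]
    [AddCommGroup Y] [Module F Y] [AddCommGroup Z] [Module F Z]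
    (n : ℕ) (x : Fin n → X) (y : Fin n → Y) (z : Fin n → Z)
    (d : ℕ) (hd : Module.finrank F (Submodule.span F (Set.range x)) = d)
    (hx0 : ∀ i, x i ≠ 0)
    (hpar : ∀ i j, i ≠ j → ∀ c : F, x j ≠ c • x i)
    (hU : ∀ α : Fin n → F,
      min ({i | α i ≠ 0}.ncard) (n - d + 2) ≤
        tensorRank2 (∑ i, α i • (y i ⊗ₜ[F] z i))) :
    tensorRank3 (∑ i, x i ⊗ₜ[F] (y i ⊗ₜ[F] z i)) = n ∧
    ∀ (v : Fin n → X) (u : Fin n → Y) (w : Fin n → Z),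
      (∑ i, x i ⊗ₜ[F] (y i ⊗ₜ[F] z i)) = ∑ i, v i ⊗ₜ[F] (u i ⊗ₜ[F] w i) →
      Multiset.map (fun i => x i ⊗ₜ[F] (y i ⊗ₜ[F] z i)) Finset.univ.val =
        Multiset.map (fun i => v i ⊗ₜ[F] (u i ⊗ₜ[F] w i)) Finset.univ.val := by
  subst hd
  have hpar' : ∀ i j, i ≠ j → x j ∉ Submodule.span F {x i} := fun i j hij hmem => by
    obtain ⟨c, hc⟩ := Submodule.mem_span_singleton.1 hmem
    exact hpar i j hij c hc.symm
  have huniq : ∀ (v : Fin n → X) (u : Fin n → Y) (w : Fin n → Z),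
      (∑ i, x i ⊗ₜ[F] (y i ⊗ₜ[F] z i)) = ∑ i, v i ⊗ₜ[F] (u i ⊗ₜ[F] w i) →
      ∃ σ : Equiv.Perm (Fin n), ∀ i,
        v i ⊗ₜ[F] (u i ⊗ₜ[F] w i) = x (σ i) ⊗ₜ[F] (y (σ i) ⊗ₜ[F] z (σ i)) :=
    fun v u w h => exists_perm_tmul_eq_of_sum_eq hx0 hpar' (by simpa using hU) h
  refine ⟨le_antisymm (Nat.sInf_le ⟨x, y, z, rfl⟩) (le_csInf ⟨n, x, y, z, rfl⟩ ?_), ?_⟩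
  · rintro m ⟨a, b, c, habc⟩
    by_contra! hm
    obtain ⟨k, rfl⟩ := Nat.exists_eq_add_of_lt hm
    have hpad : ∑ i : Fin (m + (k + 1)), Fin.append (n := k + 1) a 0 i ⊗ₜ[F]
        (Fin.append (n := k + 1) b 0 i ⊗ₜ[F] Fin.append (n := k + 1) c 0 i) =
        ∑ i, a i ⊗ₜ[F] (b i ⊗ₜ[F] c i) := by
      simp [Fin.sum_univ_add]
    obtain ⟨σ, hσ⟩ := huniq _ _ _ (habc.trans hpad.symm)
    have h0 := hσ (Fin.natAdd m (0 : Fin (k + 1)))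
    set j := σ (Fin.natAdd m (0 : Fin (k + 1)))
    rw [Fin.append_right, Pi.zero_apply, TensorProduct.zero_tmul] at h0
    obtain ⟨f, hf⟩ := not_forall.1 (mt (Module.forall_dual_apply_eq_zero_iff F (x j)).1 (hx0 j))
    have h1 := congrArg (fun t => TensorProduct.lid F _ (LinearMap.rTensor _ f t)) h0
    have h2 : y j ⊗ₜ[F] z j = 0 := by
      simpa [hf] using h1.symm
    have h3 := hU fun i => if i = j then 1 else 0
    have h4 := tensorRank2_sum_le_card (F := F) (∅ : Finset (Fin m)) (fun _ => (0 : Y))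
      (fun _ => (0 : Z))
    simp only [ite_smul, one_smul, zero_smul, Finset.sum_ite_eq', Finset.mem_univ, if_true,
      h2] at h3
    simp only [Finset.sum_empty, Finset.card_empty] at h4
    have h5 := h3.trans h4
    simp at h5
  · intro v u w h
    obtain ⟨σ, hσ⟩ := huniq v u w h
    simp only [hσ]
    conv_lhs => rw [← Multiset.map_univ_val_equiv σ, Multiset.map_map]
    rfl
end

section
/- Over the field F_2, the tensor θ = a⊗a⊗a + b⊗b⊗b + c⊗(a+b)⊗(a+b) ∈ F_2^3 ⊗ F_2^2 ⊗ F_2^2 (where a, b are the first two standard basis vectors of F_2^3 in the first factor and the standard basis of F_2^2 in the other factors, and c is the third standard basis vector of F_2^3) has tensor rank 3 and a unique representation as a sum of 3 product tensors. -/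
open TensorProduct

/-- The functional reading off the coordinate of a 3-tensor at position `(k, p, q)`. -/
noncomputable def tensorCoord (F : Type*) [Field F] {ι κ μ : Type*} (k : ι) (p : κ) (q : μ) :
    (ι → F) ⊗[F] ((κ → F) ⊗[F] (μ → F)) →ₗ[F] F :=
  LinearMap.mul' F F ∘ₗ TensorProduct.map (LinearMap.proj k)
    (LinearMap.mul' F F ∘ₗ TensorProduct.map (LinearMap.proj p) (LinearMap.proj q))

theorem tensorCoord_tmul {F : Type*} [Field F] {ι κ μ : Type*} (k : ι) (p : κ) (q : μ)
    (x : ι → F) (y : κ → F) (z : μ → F) :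
    tensorCoord F k p q (x ⊗ₜ[F] (y ⊗ₜ[F] z)) = x k * (y p * z q) := by
  simp [tensorCoord]

/-- The three nonzero vectors of `𝔽₂²`. -/
def nonzeroVec : Fin 3 → Fin 2 → ZMod 2 := ![![1, 0], ![0, 1], ![1, 1]]

/-- The product tensor `eₖ ⊗ x ⊗ x`, where `x` is the `k`-th nonzero vector of `𝔽₂²`. -/
noncomputable def diagTerm (k : Fin 3) :
    (Fin 3 → ZMod 2) ⊗[ZMod 2] ((Fin 2 → ZMod 2) ⊗[ZMod 2] (Fin 2 → ZMod 2)) :=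
  Pi.single k 1 ⊗ₜ[ZMod 2] (nonzeroVec k ⊗ₜ[ZMod 2] nonzeroVec k)

/-- On symmetric `y ⊗ z`, the coordinates with respect to the squares of the nonzero vectors. -/
def squareCoord (y z : Fin 2 → ZMod 2) : Fin 3 → ZMod 2 :=
  ![y 0 * z 0 + y 0 * z 1, y 1 * z 1 + y 0 * z 1, y 0 * z 1]

section

variable {m : ℕ} {v : Fin m → Fin 3 → ZMod 2} {u w : Fin m → Fin 2 → ZMod 2}

theorem sum_coord_eq (h : ∑ k, diagTerm k = ∑ i, v i ⊗ₜ[ZMod 2] (u i ⊗ₜ[ZMod 2] w i))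
    (k : Fin 3) (p q : Fin 2) :
    ∑ i, v i k * (u i p * w i q) = nonzeroVec k p * nonzeroVec k q := by
  have := congrArg (tensorCoord (ZMod 2) k p q) h
  simp only [map_sum, diagTerm, tensorCoord_tmul] at this
  rw [← this]
  simp [Pi.single_apply]

theorem transpose_mul_squareCoord
    (h : ∑ k, diagTerm k = ∑ i, v i ⊗ₜ[ZMod 2] (u i ⊗ₜ[ZMod 2] w i)) :
    (Matrix.of v).transpose * Matrix.of (fun i => squareCoord (u i) (w i)) = 1 := by
  ext k l
  have H := sum_coord_eq h k
  rw [Matrix.mul_apply]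
  fin_cases l <;>
    simp only [Matrix.transpose_apply, Matrix.of_apply, squareCoord, Fin.reduceFinMk,
      Fin.zero_eta, Fin.mk_one, Fin.isValue, Matrix.cons_val, mul_add,
      Finset.sum_add_distrib, H] <;>
    fin_cases k <;> decide

theorem three_le_of_sum_eq
    (h : ∑ k, diagTerm k = ∑ i, v i ⊗ₜ[ZMod 2] (u i ⊗ₜ[ZMod 2] w i)) : 3 ≤ m := by
  have H := congrArg Matrix.rank (transpose_mul_squareCoord h)
  rw [Matrix.rank_one, Fintype.card_fin] at H
  rw [← H]
  exact (Matrix.rank_mul_le_left _ _).trans (Matrix.rank_le_width _)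

end

theorem exists_eq_nonzeroVec : ∀ y z : Fin 2 → ZMod 2, squareCoord y z ≠ 0 →
    y 0 * z 1 = y 1 * z 0 →
    ∃ k, y = nonzeroVec k ∧ z = nonzeroVec k ∧ squareCoord y z = Pi.single k 1 := by
  decide

theorem map_eq_diagTerm {v : Fin 3 → Fin 3 → ZMod 2} {u w : Fin 3 → Fin 2 → ZMod 2}
    (h : ∑ k, diagTerm k = ∑ i, v i ⊗ₜ[ZMod 2] (u i ⊗ₜ[ZMod 2] w i)) :
    Multiset.map (fun i => v i ⊗ₜ[ZMod 2] (u i ⊗ₜ[ZMod 2] w i)) Finset.univ.val =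
      Multiset.map diagTerm Finset.univ.val := by
  have hl := transpose_mul_squareCoord h
  have hr := mul_eq_one_comm.mp hl
  have hdual (i j : Fin 3) : squareCoord (u i) (w i) ⬝ᵥ v j = if i = j then 1 else 0 := by
    rw [← Matrix.one_apply, ← hr]
    rfl
  have hsymm : (fun i => u i 0 * w i 1 - u i 1 * w i 0) = 0 := by
    refine Matrix.mulVec_injective_of_isUnit (IsUnit.of_mul_eq_one _ hl) ?_
    ext k
    simp only [Matrix.mulVec, dotProduct, Matrix.transpose_apply, Matrix.of_apply, mul_sub,
      Finset.sum_sub_distrib, sum_coord_eq h k]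
    simp [mul_comm]
  have hex (i : Fin 3) := exists_eq_nonzeroVec (u i) (w i)
    (fun h0 => by simpa [h0] using hdual i i) (sub_eq_zero.mp (congrFun hsymm i))
  choose σ hu hw hs using hex
  have hv (i j : Fin 3) : v j (σ i) = if i = j then 1 else 0 := by
    simpa [hs] using hdual i j
  have hσ : Function.Injective σ := fun i j hij => by
    by_contra hne
    have := hv i j
    rw [hij, hv j j] at this
    simp [hne] at this
  have hbij : Function.Bijective σ := Finite.injective_iff_bijective.mp hσ
  have hterm : (fun i => v i ⊗ₜ[ZMod 2] (u i ⊗ₜ[ZMod 2] w i)) = diagTerm ∘ σ := by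
    funext j
    have : v j = Pi.single (σ j) 1 := by
      ext k
      obtain ⟨i, rfl⟩ := hbij.2 k
      simp [hv, Pi.single_apply, hσ.eq_iff]
    simp only [Function.comp_apply, diagTerm, this, hu, hw]
  rw [hterm, ← Multiset.map_map]
  exact congrArg (Multiset.map diagTerm)
    (Multiset.map_univ_val_equiv (Equiv.ofBijective σ hbij))

/-- Over `𝔽₂`, the tensor `a⊗a⊗a + b⊗b⊗b + c⊗(a+b)⊗(a+b)` has rank 3 and a unique
representation as a sum of 3 product tensors. -/
theorem example_unique_over_F2 :
    letI F := ZMod 2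
    letI a3 : Fin 3 → F := ![1, 0, 0]
    letI b3 : Fin 3 → F := ![0, 1, 0]
    letI c3 : Fin 3 → F := ![0, 0, 1]
    letI a : Fin 2 → F := ![1, 0]
    letI b : Fin 2 → F := ![0, 1]
    letI θ := a3 ⊗ₜ[F] (a ⊗ₜ[F] a) + b3 ⊗ₜ[F] (b ⊗ₜ[F] b) +
      c3 ⊗ₜ[F] ((a + b) ⊗ₜ[F] (a + b))
    tensorRank3 θ = 3 ∧
    ∀ (v : Fin 3 → (Fin 3 → F)) (u w : Fin 3 → (Fin 2 → F)),
      θ = ∑ i, v i ⊗ₜ[F] (u i ⊗ₜ[F] w i) →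
      Multiset.map (fun i => v i ⊗ₜ[F] (u i ⊗ₜ[F] w i)) Finset.univ.val =
        {a3 ⊗ₜ[F] (a ⊗ₜ[F] a), b3 ⊗ₜ[F] (b ⊗ₜ[F] b),
         c3 ⊗ₜ[F] ((a + b) ⊗ₜ[F] (a + b))} := by
  have h0 : diagTerm 0 = ![1, 0, 0] ⊗ₜ (![1, 0] ⊗ₜ ![1, 0]) := by
    have : (Pi.single 0 1 : Fin 3 → ZMod 2) = ![1, 0, 0] := by decide
    simp [diagTerm, nonzeroVec, this]
  have h1 : diagTerm 1 = ![0, 1, 0] ⊗ₜ (![0, 1] ⊗ₜ ![0, 1]) := by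
    have : (Pi.single 1 1 : Fin 3 → ZMod 2) = ![0, 1, 0] := by decide
    simp [diagTerm, nonzeroVec, this]
  have h2 : diagTerm 2 = ![0, 0, 1] ⊗ₜ ((![1, 0] + ![0, 1]) ⊗ₜ (![1, 0] + ![0, 1])) := by
    have : (Pi.single 2 1 : Fin 3 → ZMod 2) = ![0, 0, 1] := by decide
    simp [diagTerm, nonzeroVec, this]
  rw [← h0, ← h1, ← h2, ← Fin.sum_univ_three diagTerm]
  refine ⟨le_antisymm (Nat.sInf_le ⟨_, _, _, rfl⟩) (le_csInf ⟨3, _, _, _, rfl⟩ ?_), ?_⟩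
  · rintro m ⟨v, u, w, h⟩
    exact three_le_of_sum_eq h
  · intro v u w h
    exact map_eq_diagTerm h
end
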